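/- Let k ≥ 1 and let c_1,…,c_k be integers with c_i ≥ 2 for all i, and let e_j denote the coefficient of q^j in E_k(c_1,…,c_k)_q, for 0 ≤ j ≤ d where d = (c_1−1) + ⋯ + (c_k−1). Then the sequence (e_0, e_1, …, e_d) is unimodal: there exists an index 0 ≤ j₀ ≤ d such that e_0 ≤ e_1 ≤ ⋯ ≤ e_{j₀} and e_{j₀} ≥ e_{j₀+1} ≥ ⋯ ≥ e_d. -/

import Mathlib

/-- The `q`-integer `[c]_q = 1 + q + ⋯ + q^{c-1}` in `ℤ[q]`. -/
noncomputable def qN (c : ℕ) : Polynomial ℤ := ∑ i ∈ Finset.range c, Polynomial.X ^ i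

/-- The tridiagonal matrix whose determinant is the `q`-continuant
`E_k(c_1,…,c_k)_q` (here `c` is 0-indexed: `c 0 = c_1`). -/
noncomputable def Emat (k : ℕ) (c : ℕ → ℕ) : Matrix (Fin k) (Fin k) (Polynomial ℤ) :=
  Matrix.of fun i j =>
    if (i : ℕ) = (j : ℕ) then qN (c i)
    else if (j : ℕ) = (i : ℕ) + 1 then Polynomial.X ^ (c i - 1)
    else if (i : ℕ) = (j : ℕ) + 1 then 1
    else 0

/-- The `q`-continuant `E_k(c_1,…,c_k)_q ∈ ℤ[q]` (0-indexed `c`); `Econt 0 c = 1`. -/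
noncomputable def Econt (k : ℕ) (c : ℕ → ℕ) : Polynomial ℤ := (Emat k c).det

/-- The matrix `M(c_1,…,c_k)_q = ∏_{i=1}^{k} [[ [c_i]_q, −q^{c_i−1} ], [1, 0]]` over `ℤ[q]`. -/
noncomputable def Mmat (k : ℕ) (c : ℕ → ℕ) : Matrix (Fin 2) (Fin 2) (Polynomial ℤ) :=
  ((List.range k).map fun i => !![qN (c i), -(Polynomial.X ^ (c i - 1)); 1, 0]).prod

open LaurentPolynomial in
/-- The step new element above. -/
noncomputable def fA : Matrix (Fin 2) (Fin 2) (LaurentPolynomial ℤ) := !![T 1, 0; 1, 1]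

open LaurentPolynomial in
/-- The step new element below. -/
noncomputable def fB : Matrix (Fin 2) (Fin 2) (LaurentPolynomial ℤ) := !![T 1, T 1; 0, 1]

/-- Transfer matrix of a word. -/
noncomputable def mw : List Bool → Matrix (Fin 2) (Fin 2) (LaurentPolynomial ℤ)
  | [] => 1
  | true :: w => fA * mw w
  | false :: w => fB * mw w

theorem mw_append (u v : List Bool) : mw (u ++ v) = mw u * mw v := by
  induction u with
  | nil => simp [mw]
  | cons b u ih => cases b <;> simp [mw, ih, mul_assoc]

open LaurentPolynomial in
/-- Rank polynomial of the fence of a word. -/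
noncomputable def rk (w : List Bool) : LaurentPolynomial ℤ :=
  T 1 * mw w 0 0 + mw w 0 1 + T 1 * mw w 1 0 + mw w 1 1

open LaurentPolynomial in
theorem A00 (w) : mw (true :: w) 0 0 = T 1 * mw w 0 0 := by
  simp only [mw, fA, Matrix.mul_apply, Fin.sum_univ_two]; simp
open LaurentPolynomial in
theorem A01 (w) : mw (true :: w) 0 1 = T 1 * mw w 0 1 := by
  simp only [mw, fA, Matrix.mul_apply, Fin.sum_univ_two]; simp
theorem A10 (w) : mw (true :: w) 1 0 = mw w 0 0 + mw w 1 0 := by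
  simp only [mw, fA, Matrix.mul_apply, Fin.sum_univ_two]; simp
theorem A11 (w) : mw (true :: w) 1 1 = mw w 0 1 + mw w 1 1 := by
  simp only [mw, fA, Matrix.mul_apply, Fin.sum_univ_two]; simp
open LaurentPolynomial in
theorem B00 (w) : mw (false :: w) 0 0 = T 1 * (mw w 0 0 + mw w 1 0) := by
  simp only [mw, fB, Matrix.mul_apply, Fin.sum_univ_two]; simp [add_mul]
open LaurentPolynomial in
theorem B01 (w) : mw (false :: w) 0 1 = T 1 * (mw w 0 1 + mw w 1 1) := by
  simp only [mw, fB, Matrix.mul_apply, Fin.sum_univ_two]; simp [add_mul]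
theorem B10 (w) : mw (false :: w) 1 0 = mw w 1 0 := by
  simp only [mw, fB, Matrix.mul_apply, Fin.sum_univ_two]; simp
theorem B11 (w) : mw (false :: w) 1 1 = mw w 1 1 := by
  simp only [mw, fB, Matrix.mul_apply, Fin.sum_univ_two]; simp

open LaurentPolynomial in
theorem rA0 (w i) : mw (w ++ [true]) i 0 = T 1 * mw w i 0 + mw w i 1 := by
  rw [mw_append, Matrix.mul_apply, Fin.sum_univ_two]; simp [mw, fA]
theorem rA1 (w i) : mw (w ++ [true]) i 1 = mw w i 1 := by
  rw [mw_append, Matrix.mul_apply, Fin.sum_univ_two]; simp [mw, fA]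
open LaurentPolynomial in
theorem rB0 (w i) : mw (w ++ [false]) i 0 = T 1 * mw w i 0 := by
  rw [mw_append, Matrix.mul_apply, Fin.sum_univ_two]; simp [mw, fB]
open LaurentPolynomial in
theorem rB1 (w i) : mw (w ++ [false]) i 1 = T 1 * mw w i 0 + mw w i 1 := by
  rw [mw_append, Matrix.mul_apply, Fin.sum_univ_two]; simp [mw, fB]

theorem n00 : mw [] 0 0 = 1 := by simp [mw]
theorem n01 : mw [] 0 1 = 0 := by simp [mw]
theorem n10 : mw [] 1 0 = 0 := by simp [mw]
theorem n11 : mw [] 1 1 = 1 := by simp [mw]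

/-! Symmetry of the circular rank polynomials. -/

theorem coeff_T_mul (a : ℤ) (P : LaurentPolynomial ℤ) (i : ℤ) :
    (LaurentPolynomial.T a * P).coeff i = P.coeff (i - a) := by
  rw [LaurentPolynomial.T, AddMonoidAlgebra.coeff_single_mul_apply]
  rw [one_mul]; congr 1; ring

open LaurentPolynomial in
/-- conjugating matrix -/
noncomputable def fG : Matrix (Fin 2) (Fin 2) (LaurentPolynomial ℤ) :=
  !![1, 1 - T 1; T 1 - 1, T 1]

open LaurentPolynomial in
theorem conj_mw (w : List Bool) :
    (T (w.length : ℤ) : LaurentPolynomial ℤ) • ((mw w).map invert * fG) = fG * mw w := by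
  have hq : (T 1 : LaurentPolynomial ℤ) * T (-1) = 1 := by rw [← T_add]; simp
  have hA : (T 1 : LaurentPolynomial ℤ) • (fA.map invert * fG) = fG * fA := by
    ext i j : 1
    fin_cases i <;> fin_cases j <;>
      simp only [fA, fG, Matrix.smul_apply, Matrix.mul_apply, Fin.sum_univ_two, smul_eq_mul,
        Matrix.map_apply] <;> simp [-T_mul] <;> first
      | ring1
      | linear_combination hq
      | linear_combination (1 - T 1) * hq
      | linear_combination (T 1) * hq
  have hB : (T 1 : LaurentPolynomial ℤ) • (fB.map invert * fG) = fG * fB := by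
    ext i j : 1
    fin_cases i <;> fin_cases j <;>
      simp only [fB, fG, Matrix.smul_apply, Matrix.mul_apply, Fin.sum_univ_two, smul_eq_mul,
        Matrix.map_apply] <;> simp [-T_mul] <;> first
      | ring1
      | linear_combination hq
      | linear_combination (1 - T 1) * hq
      | linear_combination (T 1) * hq
  have key : ∀ (X Y : Matrix (Fin 2) (Fin 2) (LaurentPolynomial ℤ)) (n : ℕ),
      (T 1 : LaurentPolynomial ℤ) • (X.map invert * fG) = fG * X →
      (T (n : ℤ) : LaurentPolynomial ℤ) • (Y.map invert * fG) = fG * Y →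
      (T ((n + 1 : ℕ) : ℤ) : LaurentPolynomial ℤ) • ((X * Y).map invert * fG) = fG * (X * Y) := by
    intro X Y n hX hY
    rw [← mul_assoc, ← hX, Matrix.smul_mul, mul_assoc, ← hY, Matrix.mul_smul, smul_smul, ← T_add,
      Matrix.map_mul, mul_assoc]
    congr 2
    push_cast; ring
  induction w with
  | nil => simp [mw]
  | cons b w ih =>
    cases b
    · exact key _ _ _ hB ih
    · exact key _ _ _ hA ih

open LaurentPolynomial in
theorem tr_symm (w : List Bool) (i : ℤ) :
    (mw w 0 0 + mw w 1 1).coeff i = (mw w 0 0 + mw w 1 1).coeff (w.length - i) := by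
  have h := conj_mw w
  have e (i j) := congrFun (congrFun h i) j
  have e00 := e 0 0
  have e01 := e 0 1
  have e10 := e 1 0
  have e11 := e 1 1
  simp only [fG, Matrix.smul_apply, Matrix.mul_apply, Fin.sum_univ_two, smul_eq_mul,
        Matrix.map_apply, Matrix.of_apply, Matrix.cons_val_zero, Matrix.cons_val_one,
        Matrix.cons_val', Matrix.cons_val_fin_one] at e00 e01 e10 e11
  have hne : (1 - T 1 + T 1 * T 1 : LaurentPolynomial ℤ) ≠ 0 := by
    intro h0
    have := congrArg (fun P : LaurentPolynomial ℤ => P.coeff 0) h0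
    rw [← T_add, ← T_zero] at this
    simp at this
  have main : (1 - T 1 + T 1 * T 1 : LaurentPolynomial ℤ) *
      (T (w.length : ℤ) * invert (mw w 0 0 + mw w 1 1)) =
      (1 - T 1 + T 1 * T 1 : LaurentPolynomial ℤ) * (mw w 0 0 + mw w 1 1) := by
    rw [map_add]
    linear_combination T 1 * e00 - (T 1 - 1) * e01 - (1 - T 1) * e10 + e11
  have main2 := mul_left_cancel₀ hne main
  conv_lhs => rw [← main2]
  rw [coeff_T_mul, invert_apply]
  congr 1; ring

/-! Left- and right-heavy sequences. -/

/-- left heavy -/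
def Lft (m : ℤ) (f : ℤ → ℤ) : Prop := ∀ i, 2 * i ≤ m → f (m - i) ≤ f i
/-- right heavy -/
def Rgt (m : ℤ) (f : ℤ → ℤ) : Prop := ∀ i, 2 * i ≤ m → f i ≤ f (m - i)
/-- interlacing sequences -/
def Good (n : ℤ) (f : ℤ → ℤ) : Prop := Lft (n + 1) f ∧ Rgt (n - 1) f ∧ (Lft n f ∨ Rgt n f)

theorem Good.dec1 {n f} (h : Good n f) (j : ℤ) (hj : n ≤ 2 * j) : f (j + 1) ≤ f j := by
  obtain ⟨h1, h2, h3 | h3⟩ := h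
  · have a := h3 (n - 1 - j) (by omega)
    have b := h2 (n - 1 - j) (by omega)
    rw [show n - (n - 1 - j) = j + 1 by ring] at a
    rw [show n - 1 - (n - 1 - j) = j by ring] at b
    omega
  · have a := h3 (n - j) (by omega)
    have b := h1 (n - j) (by omega)
    rw [show n - (n - j) = j by ring] at a
    rw [show n + 1 - (n - j) = j + 1 by ring] at b
    omega

theorem Good.inc1 {n f} (h : Good n f) (i : ℤ) (hi : 2 * i + 2 ≤ n) : f i ≤ f (i + 1) := by
  obtain ⟨h1, h2, h3 | h3⟩ := h
  · have a := h3 (i + 1) (by omega)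
    have b := h2 i (by omega)
    rw [show n - (i + 1) = n - 1 - i by ring] at a
    omega
  · have a := h3 i (by omega)
    have b := h1 (i + 1) (by omega)
    rw [show n + 1 - (i + 1) = n - i by ring] at b
    omega

theorem Good.dec {n f} (h : Good n f) (i j : ℤ) (hi : n ≤ 2 * i) (hij : i ≤ j) : f j ≤ f i := by
  induction j, hij using Int.leInduction with
  | base => exact le_rfl
  | succ k hk ih => exact (h.dec1 k (by omega)).trans ih

theorem Good.inc {n f} (h : Good n f) (i j : ℤ) (hij : i ≤ j) (hj : 2 * j ≤ n) : f i ≤ f j := by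
  induction j, hij using Int.leInduction with
  | base => exact le_rfl
  | succ k hk ih => exact (ih (by omega)).trans (h.inc1 k (by omega))

theorem Good.lftAll {n f} (h : Good n f) (m : ℤ) (hm : n + 1 ≤ m) : Lft m f := by
  intro i hi
  by_cases h1 : 2 * i ≤ n + 1
  · exact (h.dec (n + 1 - i) (m - i) (by omega) (by omega)).trans (h.1 i h1)
  · exact h.dec i (m - i) (by omega) (by omega)

theorem Good.rgtAll {n f} (h : Good n f) (m : ℤ) (hm : m ≤ n - 1) : Rgt m f := by
  intro i hi
  by_cases h1 : 2 * (m - i) ≤ n - 1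
  · exact h.inc i (m - i) (by omega) (by omega)
  · have := h.2.1 (n - 1 - (m - i)) (by omega)
    rw [show n - 1 - (n - 1 - (m - i)) = m - i by ring] at this
    exact (h.inc i (n - 1 - (m - i)) (by omega) (by omega)).trans this

/-- left heavy Laurent polynomials -/
def LftP (m : ℤ) (P : LaurentPolynomial ℤ) : Prop := Lft m P.coeff
/-- right heavy Laurent polynomials -/
def RgtP (m : ℤ) (P : LaurentPolynomial ℤ) : Prop := Rgt m P.coeff

theorem LftP.shift {m P} (h : LftP m P) (a m' : ℤ) (hm : m' = m + 2 * a) :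
    LftP m' (LaurentPolynomial.T a * P) := by
  intro i hi
  rw [coeff_T_mul, coeff_T_mul]
  have := h (i - a) (by omega)
  rwa [show m - (i - a) = m' - i - a by omega] at this

theorem RgtP.shift {m P} (h : RgtP m P) (a m' : ℤ) (hm : m' = m + 2 * a) :
    RgtP m' (LaurentPolynomial.T a * P) := by
  intro i hi
  rw [coeff_T_mul, coeff_T_mul]
  have := h (i - a) (by omega)
  rwa [show m - (i - a) = m' - i - a by omega] at this

/-- Rank polynomials of fences with `n` elements, including the empty one. -/
def Fen (n : ℤ) (P : LaurentPolynomial ℤ) : Prop :=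
  (n = 0 ∧ P = 1) ∨ ∃ w : List Bool, n = w.length + 1 ∧ P = rk w

theorem Fen.nonneg {n P} (h : Fen n P) : 0 ≤ n := by
  rcases h with ⟨h, -⟩ | ⟨w, h, -⟩ <;> omega

theorem fen_zero : Fen 0 1 := Or.inl ⟨rfl, rfl⟩
theorem fen_rk (w : List Bool) : Fen (w.length + 1) (rk w) := Or.inr ⟨w, rfl, rfl⟩

open LaurentPolynomial in
theorem T_succ_mul (a : ℤ) (P : LaurentPolynomial ℤ) : T 1 * (T a * P) = T (a + 1) * P := by
  rw [add_comm, T_add, mul_assoc]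

theorem col1 (w : List Bool) : ∃ n P, Fen n P ∧ n ≤ w.length ∧ mw w 0 1 + mw w 1 1 = P := by
  induction w using List.reverseRecOn with
  | nil => exact ⟨0, 1, fen_zero, by simp, by simp [n01, n11]⟩
  | append_singleton w b ih =>
    cases b
    · refine ⟨_, _, fen_rk w, by simp, ?_⟩
      rw [rB1, rB1, rk]; ring
    · obtain ⟨n, P, h1, h2, h3⟩ := ih
      refine ⟨n, P, h1, by simp; omega, ?_⟩
      rw [rA1, rA1, h3]

open LaurentPolynomial in
theorem col0 (w : List Bool) : ∃ n P, Fen n P ∧ n ≤ w.length ∧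
    mw w 0 0 + mw w 1 0 = T (w.length - n) * P := by
  induction w using List.reverseRecOn with
  | nil => exact ⟨0, 1, fen_zero, by simp, by simp [n00, n10]⟩
  | append_singleton w b ih =>
    cases b
    · obtain ⟨n, P, h1, h2, h3⟩ := ih
      refine ⟨n, P, h1, by simp; omega, ?_⟩
      rw [rB0, rB0, ← mul_add, h3, T_succ_mul]
      congr 2; simp; ring
    · refine ⟨_, _, fen_rk w, by simp, ?_⟩
      rw [rA0, rA0, rk]; simp [-T_mul]; ring

theorem ent11 (w : List Bool) : ∃ n P, Fen n P ∧ n ≤ w.length ∧ mw w 1 1 = P := by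
  induction w with
  | nil => exact ⟨0, 1, fen_zero, by simp, n11⟩
  | cons b w ih =>
    cases b
    · obtain ⟨n, P, h1, h2, h3⟩ := ih
      exact ⟨n, P, h1, by simp; omega, by rw [B11, h3]⟩
    · obtain ⟨n, P, h1, h2, h3⟩ := col1 w
      exact ⟨n, P, h1, by simp; omega, by rw [A11, h3]⟩

open LaurentPolynomial in
theorem ent00 (w : List Bool) : ∃ n P, Fen n P ∧ n ≤ w.length ∧
    mw w 0 0 = T (w.length - n) * P := by
  induction w with
  | nil => exact ⟨0, 1, fen_zero, by simp, by simp [n00]⟩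
  | cons b w ih =>
    cases b
    · obtain ⟨n, P, h1, h2, h3⟩ := col0 w
      refine ⟨n, P, h1, by simp; omega, ?_⟩
      rw [B00, h3, T_succ_mul]
      congr 2; simp; ring
    · obtain ⟨n, P, h1, h2, h3⟩ := ih
      refine ⟨n, P, h1, by simp; omega, ?_⟩
      rw [A00, h3, T_succ_mul]
      congr 2; simp; ring

open LaurentPolynomial in
theorem row0 (w : List Bool) : ∃ n P, Fen n P ∧ n ≤ w.length ∧
    T 1 * mw w 0 0 + mw w 0 1 = T (w.length + 1 - n) * P := by
  induction w with
  | nil => exact ⟨0, 1, fen_zero, by simp, by simp [n00, n01]⟩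
  | cons b w ih =>
    cases b
    · refine ⟨_, _, fen_rk w, by simp, ?_⟩
      rw [B00, B01, rk]
      simp only [List.length_cons, Nat.cast_add, Nat.cast_one, add_sub_cancel_left]
      ring
    · obtain ⟨n, P, h1, h2, h3⟩ := ih
      refine ⟨n, P, h1, by simp; omega, ?_⟩
      rw [A00, A01, ← mul_add, h3, T_succ_mul]
      congr 2; simp; ring

open LaurentPolynomial in
theorem row1 (w : List Bool) : ∃ n P, Fen n P ∧ n ≤ w.length ∧
    T 1 * mw w 1 0 + mw w 1 1 = P := by
  induction w with
  | nil => exact ⟨0, 1, fen_zero, by simp, by simp [n10, n11]⟩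
  | cons b w ih =>
    cases b
    · obtain ⟨n, P, h1, h2, h3⟩ := ih
      exact ⟨n, P, h1, by simp; omega, by rw [B10, B11, h3]⟩
    · refine ⟨_, _, fen_rk w, by simp, ?_⟩
      rw [A10, A11, rk]; ring

theorem lft_of_sub {m C D} (hC : ∀ i : ℤ, (C : LaurentPolynomial ℤ).coeff i = C.coeff (m - i))
    (hD : LftP m D) : LftP m (C + D) := by
  intro i hi
  have := hD i hi
  have := hC i
  simp only [AddMonoidAlgebra.coeff_add, Finsupp.add_apply] at *
  omega

theorem rgt_of_sub {m C D} (hC : ∀ i : ℤ, (C : LaurentPolynomial ℤ).coeff i = C.coeff (m - i))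
    (hD : RgtP m D) : RgtP m (C + D) := by
  intro i hi
  have := hD i hi
  have := hC i
  simp only [AddMonoidAlgebra.coeff_add, Finsupp.add_apply] at *
  omega

theorem LftP.neg {m P} (h : LftP m P) : RgtP m (-P) := by
  intro i hi
  have := h i hi
  simp only [AddMonoidAlgebra.coeff_neg, Finsupp.neg_apply] at *
  omega

theorem RgtP.neg {m P} (h : RgtP m P) : LftP m (-P) := by
  intro i hi
  have := h i hi
  simp only [AddMonoidAlgebra.coeff_neg, Finsupp.neg_apply] at *
  omega

open LaurentPolynomial in
/-- The sign: the defect of the linear fence relative to a circular one is one-sided. -/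
theorem sign (w : List Bool)
    (ih : ∀ n P, Fen n P → n ≤ w.length → Good n P.coeff) :
    (∃ D, (LftP (w.length + 1) D ∨ RgtP (w.length + 1) D) ∧ (D = mw w 0 1 ∨ D = T 1 * mw w 1 0)) := by
  have two : ∀ n P, Fen n P → n = w.length - 1 →
      (LftP (w.length + 1) (T 1 * P) ∨ RgtP (w.length + 1) (T 1 * P)) := by
    intro n P hF hn
    rcases (ih n P hF (by omega)).2.2 with h | h
    · exact Or.inl (LftP.shift h 1 _ (by omega))
    · exact Or.inr (RgtP.shift h 1 _ (by omega))
  rcases w with _ | ⟨b, u⟩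
  · refine ⟨mw [] 0 1, Or.inl ?_, Or.inl rfl⟩
    rw [n01]; intro i hi; simp
  rcases List.eq_nil_or_concat u with rfl | ⟨v, bb, hv⟩
  · have h := two 0 1 fen_zero (by simp)
    cases b
    · exact ⟨_, h, Or.inl (by rw [B01, n01, n11]; simp)⟩
    · exact ⟨_, h, Or.inr (by rw [A10, n00, n10]; simp)⟩
  rw [List.concat_eq_append] at hv
  subst hv
  cases b <;> cases bb
  · -- B v B
    exact ⟨_, two _ _ (fen_rk v) (by simp), Or.inl (by rw [B01, rB1, rB1, rk]; ring)⟩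
  · -- B v A
    obtain ⟨n, P, h1, h2, h3⟩ := row1 v
    refine ⟨T 1 * P, Or.inl ?_, Or.inr (by rw [B10, rA0, h3])⟩
    have := (ih n P h1 (by simp; omega)).lftAll (v.length + 1) (by omega)
    exact LftP.shift this 1 _ (by simp; omega)
  · -- A v B
    obtain ⟨n, P, h1, h2, h3⟩ := row0 v
    refine ⟨T (v.length + 1 - n + 1) * P, Or.inr ?_, Or.inl (by rw [A01, rB1, h3, T_succ_mul])⟩
    have := (ih n P h1 (by simp; omega)).rgtAll (2 * n - v.length - 1) (by omega)
    exact RgtP.shift this _ _ (by simp; omega)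
  · -- A v A
    exact ⟨_, two _ _ (fen_rk v) (by simp), Or.inr (by rw [A10, rA0, rA0, rk]; ring)⟩

open LaurentPolynomial in
theorem good_step (w : List Bool)
    (ih : ∀ n P, Fen n P → n ≤ w.length → Good n P.coeff) :
    Good (w.length + 1) (rk w).coeff := by
  refine ⟨?_, ?_, ?_⟩
  · obtain ⟨n, P, h1, h2, h3⟩ := ent00 w
    have e : rk w = (mw (false :: true :: w) 0 0 + mw (false :: true :: w) 1 1) +
        -(T (w.length - n + 2) * P) := by
      have : T (w.length - n + 2) * P = T 1 * (T 1 * mw w 0 0) := by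
        rw [h3, T_succ_mul (w.length - n), T_succ_mul]; congr 2; ring
      rw [this, B00, B11, A00, A10, A11, rk]; ring
    rw [e]
    refine lft_of_sub (fun i => ?_) (RgtP.neg ?_)
    · convert! tr_symm (false :: true :: w) i using 2
    · have := (ih n P h1 h2).rgtAll (2 * n - w.length - 2) (by omega)
      exact RgtP.shift this _ _ (by omega)
  · obtain ⟨n, P, h1, h2, h3⟩ := ent11 w
    have e : rk w = T (-1) * ((mw (true :: false :: w) 0 0 + mw (true :: false :: w) 1 1) + -P) := by
      have hq : (T (-1) : LaurentPolynomial ℤ) * T 1 = 1 := by rw [← T_add]; simp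
      rw [← h3, A00, A11, B00, B01, B11, rk]
      linear_combination -(T 1 * mw w 0 0 + mw w 0 1 + T 1 * mw w 1 0 + mw w 1 1) * hq
    rw [e]
    refine RgtP.shift (m := w.length + 2) (rgt_of_sub (fun i => ?_) (LftP.neg ?_)) _ _ (by omega)
    · convert! tr_symm (true :: false :: w) i using 2
    · exact (ih n P h1 h2).lftAll _ (by omega)
  · obtain ⟨D, hD, rfl | rfl⟩ := sign w ih
    · have e : rk w = (mw (false :: w) 0 0 + mw (false :: w) 1 1) + mw w 0 1 := by
        rw [B00, B11, rk]; ring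
      have hC := tr_symm (false :: w)
      rw [e]
      exact hD.imp (fun h => lft_of_sub (by simpa using hC) h) (fun h => rgt_of_sub (by simpa using hC) h)
    · have e : rk w = (mw (true :: w) 0 0 + mw (true :: w) 1 1) + T 1 * mw w 1 0 := by
        rw [A00, A11, rk]; ring
      have hC := tr_symm (true :: w)
      rw [e]
      exact hD.imp (fun h => lft_of_sub (by simpa using hC) h) (fun h => rgt_of_sub (by simpa using hC) h)

theorem good_one : Good 0 (1 : LaurentPolynomial ℤ).coeff := by
  have h (i : ℤ) : (1 : LaurentPolynomial ℤ).coeff i = if 0 = i then 1 else 0 := by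
    rw [← LaurentPolynomial.T_zero, LaurentPolynomial.T_apply]
  refine ⟨?_, ?_, Or.inl ?_⟩ <;> intro i hi <;> simp only [h] <;> split_ifs <;> omega

theorem good_all (N : ℕ) : ∀ n P, Fen n P → n ≤ N → Good n P.coeff := by
  induction N with
  | zero =>
    rintro n P (⟨rfl, rfl⟩ | ⟨w, rfl, rfl⟩) h
    · exact good_one
    · simp at h; omega
  | succ N ih =>
    rintro n P (⟨rfl, rfl⟩ | ⟨w, rfl, rfl⟩) h
    · exact good_one
    · exact good_step w fun n P hF hn => ih n P hF (by push_cast at h; omega)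

theorem good_rk (w : List Bool) : Good (w.length + 1) (rk w).coeff :=
  good_step w (good_all w.length)

/-! The link with continuants. -/

open LaurentPolynomial in
/-- `E`, `O` are the total / first element out polynomials of a fence. -/
def St (n : ℕ) (E O : Polynomial ℤ) : Prop :=
  ∃ w : List Bool, w.length + 1 = n ∧ Polynomial.toLaurent E = rk w ∧
    Polynomial.toLaurent O = T 1 * mw w 1 0 + mw w 1 1

open Polynomial in
theorem St.below {n E O} (h : St n E O) : St (n + 1) (X * E + O) O := by
  obtain ⟨w, h1, h2, h3⟩ := h
  refine ⟨false :: w, by simp [h1], ?_, by rw [B10, B11, h3]⟩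
  rw [map_add, map_mul, toLaurent_X, h2, h3, rk, rk, B00, B01, B10, B11]; ring

open Polynomial in
theorem St.above {n E O} (h : St n E O) : St (n + 1) ((1 + X) * E - X * O) E := by
  obtain ⟨w, h1, h2, h3⟩ := h
  refine ⟨true :: w, by simp [h1], ?_, by rw [A10, A11, h2, rk]; ring⟩
  rw [map_sub, map_mul, map_mul, map_add, map_one, toLaurent_X, h2, h3, rk, rk, A00, A01, A10, A11]
  ring

open Polynomial in
theorem St.belows {n E O} (h : St n E O) (m : ℕ) : St (n + m) (X ^ m * E + qN m * O) O := by
  induction m with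
  | zero => simpa [qN] using h
  | succ m ih =>
    convert! ih.below using 1
    have : qN (m + 1) = X * qN m + 1 := by
      rw [qN, qN, Finset.sum_range_succ', Finset.mul_sum]
      simp [pow_succ']
    rw [this]; ring

open Polynomial in
theorem qN_succ (m : ℕ) : qN (m + 1) = qN m + X ^ m := by
  rw [qN, qN, Finset.sum_range_succ]

open Polynomial in
theorem Econt_rec (k : ℕ) (c : ℕ → ℕ) : Econt (k + 2) c =
    qN (c 0) * Econt (k + 1) (fun i => c (i + 1)) - X ^ (c 0 - 1) * Econt k (fun i => c (i + 2)) := by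
  have hsub : (Emat (k + 2) c).submatrix Fin.succ Fin.succ = Emat (k + 1) (fun i => c (i + 1)) := by
    ext1 i j
    simp [Emat]
  have hsub2 : (Emat (k + 2) c).submatrix (fun i : Fin k => i.succ.succ) (fun i => i.succ.succ)
      = Emat k (fun i => c (i + 2)) := by
    ext1 i j
    simp [Emat]
  unfold Econt
  rw [Matrix.det_succ_row_zero, Fin.sum_univ_succ, Fin.sum_univ_succ]
  rw [Finset.sum_eq_zero (s := Finset.univ) (f := fun i : Fin k => _)]
  · have h2 : ((Emat (k + 2) c).submatrix Fin.succ (Fin.succAbove (Fin.succ 0))).det =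
        (Emat k (fun i => c (i + 2))).det := by
      rw [Matrix.det_succ_column_zero, Fin.sum_univ_succ, Finset.sum_eq_zero]
      · rw [← hsub2, Matrix.submatrix_submatrix]
        have e : (Emat (k + 2) c).submatrix (Fin.succ ∘ Fin.succAbove 0)
            ((Fin.succAbove (Fin.succ 0)) ∘ Fin.succ) =
            (Emat (k + 2) c).submatrix (fun i : Fin k => i.succ.succ) (fun i => i.succ.succ) := by
          ext1 i j
          simp
        rw [e]
        simp [Emat]
      · intro i _
        simp [Emat]
    rw [h2]
    have h1 : (Emat (k + 2) c).submatrix Fin.succ (Fin.succAbove 0) =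
        Emat (k + 1) (fun i => c (i + 1)) := by
      rw [← hsub]; rfl
    rw [h1]
    simp [Emat]
    ring
  · intro i _
    simp [Emat]

theorem Econt_zero (c : ℕ → ℕ) : Econt 0 c = 1 := by simp [Econt]
theorem Econt_one (c : ℕ → ℕ) : Econt 1 c = qN (c 0) := by simp [Econt, Emat]

open Polynomial in
theorem St_Econt (k : ℕ) : ∀ c : ℕ → ℕ, (∀ i < k + 1, 2 ≤ c i) →
    St (∑ i ∈ Finset.range (k + 1), (c i - 1)) (Econt (k + 1) c) (Econt k fun i => c (i + 1)) := by
  induction k with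
  | zero =>
    intro c hc
    obtain ⟨m, hm⟩ : ∃ m, c 0 = m + 2 := ⟨c 0 - 2, by have := hc 0 (by omega); omega⟩
    have h0 : St 1 (1 + X) 1 := by
      refine ⟨[], rfl, ?_, ?_⟩
      · rw [rk, n00, n01, n10, n11, map_add, map_one, toLaurent_X]; ring
      · rw [n10, n11]; simp
    have h := h0.belows m
    rw [Econt_one, Econt_zero]
    convert! h using 1
    · simp [hm]; omega
    · rw [hm, qN_succ, qN_succ]; ring
  | succ k ih =>
    intro c hc
    obtain ⟨m, hm⟩ : ∃ m, c 0 = m + 2 := ⟨c 0 - 2, by have := hc 0 (by omega); omega⟩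
    have h := ((ih (fun i => c (i + 1)) (fun i hi => hc (i + 1) (by omega))).above).belows m
    convert! h using 1
    · rw [Finset.sum_range_succ', hm]; omega
    · rw [Econt_rec, hm, qN_succ, qN_succ, show m + 2 - 1 = m + 1 by omega]; ring

/-- for `k ≥ 1` and integers `c_i ≥ 2`, the sequence of coefficients
`e_0, …, e_d` of `E_k(c_1,…,c_k)_q` (where `d = (c_1−1) + ⋯ + (c_k−1)`) is unimodal:
there is `j₀ ≤ d` such that the coefficients weakly increase up to `j₀` and weakly
decrease from `j₀` to `d`. -/
theorem Econt_unimodal (k : ℕ) (hk : 1 ≤ k) (c : ℕ → ℕ) (hc : ∀ i < k, 2 ≤ c i) :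
    ∃ j₀ ≤ ∑ i ∈ Finset.range k, (c i - 1),
      (∀ j, j + 1 ≤ j₀ → (Econt k c).coeff j ≤ (Econt k c).coeff (j + 1)) ∧
      (∀ j, j₀ ≤ j → j + 1 ≤ ∑ i ∈ Finset.range k, (c i - 1) →
        (Econt k c).coeff (j + 1) ≤ (Econt k c).coeff j) := by
  obtain ⟨k, rfl⟩ : ∃ k', k = k' + 1 := ⟨k - 1, by omega⟩
  obtain ⟨w, h1, h2, -⟩ := St_Econt k c hc
  have hg := good_rk w
  have hco : ∀ j : ℕ, (Econt (k + 1) c).coeff j = (rk w).coeff (j : ℤ) := by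
    intro j
    rw [← h2, Polynomial.toLaurent_apply]
    exact (Finsupp.mapDomain_apply Nat.cast_injective _ _).symm
  rw [← h1]
  have hinc : ∀ j : ℕ, 2 * (j + 1) ≤ w.length + 1 →
      (Econt (k + 1) c).coeff j ≤ (Econt (k + 1) c).coeff (j + 1) := by
    intro j hj
    rw [hco, hco]
    exact hg.inc _ _ (by omega) (by omega)
  have hdec : ∀ j : ℕ, w.length + 1 ≤ 2 * j →
      (Econt (k + 1) c).coeff (j + 1) ≤ (Econt (k + 1) c).coeff j := by
    intro j hj
    rw [hco, hco]
    exact hg.dec _ _ (by omega) (by omega)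
  obtain ⟨p, hp | hp⟩ : ∃ p, w.length + 1 = 2 * p ∨ w.length + 1 = 2 * p + 1 :=
    ⟨(w.length + 1) / 2, by omega⟩
  · exact ⟨p, by omega, fun j hj => hinc j (by omega), fun j hj _ => hdec j (by omega)⟩
  · rcases le_total ((Econt (k + 1) c).coeff (p + 1)) ((Econt (k + 1) c).coeff p) with h | h
    · refine ⟨p, by omega, fun j hj => hinc j (by omega), fun j hj _ => ?_⟩
      rcases hj.eq_or_lt with rfl | hj
      · exact h
      · exact hdec j (by omega)
    · refine ⟨p + 1, by omega, fun j hj => ?_, fun j hj _ => hdec j (by omega)⟩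
      rcases (show j ≤ p by omega).eq_or_lt with rfl | hj
      · exact h
      · exact hinc j (by omega)
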